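/- (Busemann–Petty type theorem for complex lines.) Let A and B be origin-symmetric star bodies in ℂⁿ (n ≥ 1), and assume A is circular, i.e., e^{iθ}z ∈ A for all z ∈ A and θ ∈ ℝ. If for every unit vector ω ∈ S^{2n-1} one has area(A ∩ ℂω) ≤ area(B ∩ ℂω), then vol(A) ≤ vol(B). -/

import Mathlib

open MeasureTheory Metric
open scoped ENNReal

noncomputable instance (n : ℕ) : MeasurableSpace (EuclideanSpace ℂ (Fin n)) := borel _
instance (n : ℕ) : BorelSpace (EuclideanSpace ℂ (Fin n)) := ⟨rfl⟩

/-- The radial function of a set `D ⊆ ℂⁿ`: `ρ_D(ω) = max {t ≥ 0 | t • ω ∈ D}`. -/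
noncomputable def radialFn {n : ℕ} (D : Set (EuclideanSpace ℂ (Fin n)))
    (ω : EuclideanSpace ℂ (Fin n)) : ℝ :=
  sSup {t : ℝ | 0 ≤ t ∧ t • ω ∈ D}

/-- A star body in `ℂⁿ ≅ ℝ^{2n}`: a compact set containing the origin in its interior,
star-shaped with respect to the origin, whose radial function is continuous on the unit
sphere. -/
def IsStarBody {n : ℕ} (D : Set (EuclideanSpace ℂ (Fin n))) : Prop :=
  IsCompact D ∧ (0 : EuclideanSpace ℂ (Fin n)) ∈ interior D ∧
    (∀ x ∈ D, ∀ t : ℝ, 0 ≤ t → t ≤ 1 → t • x ∈ D) ∧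
    ContinuousOn (radialFn D) (sphere (0 : EuclideanSpace ℂ (Fin n)) 1)

/-- `D` is circular (with center 0): stable under multiplication by unit complex numbers. -/
def IsCircular {n : ℕ} (D : Set (EuclideanSpace ℂ (Fin n))) : Prop :=
  ∀ z ∈ D, ∀ θ : ℝ, Complex.exp (θ * Complex.I) • z ∈ D

/-- The complex line `ℂω = {zω : z ∈ ℂ}` through `ω`. -/
def complexLine {n : ℕ} (ω : EuclideanSpace ℂ (Fin n)) : Set (EuclideanSpace ℂ (Fin n)) :=
  Set.range fun z : ℂ => z • ω

/-- If `w ≤ c` on `A` and `c ≤ w` off `A`, then `A` has the least `w`-mass among the sets whose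
measure is at least that of `A`. -/
theorem setLIntegral_le_setLIntegral_of_measure_le {α : Type*} [MeasurableSpace α]
    {ν : Measure α} {A B : Set α} (hA : MeasurableSet A) (hB : MeasurableSet B)
    (hfin : ν A ≠ ∞) (hle : ν A ≤ ν B) {w : α → ℝ≥0∞} {c : ℝ≥0∞}
    (hwA : ∀ z ∈ A, w z ≤ c) (hwB : ∀ z ∉ A, c ≤ w z) :
    ∫⁻ z in A, w z ∂ν ≤ ∫⁻ z in B, w z ∂ν := by
  have hdiff : ν (A \ B) ≤ ν (B \ A) := by
    have hinter : ν (A ∩ B) ≠ ∞ := measure_ne_top_of_subset Set.inter_subset_left hfin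
    rw [← measure_inter_add_sdiff A hB, ← measure_inter_add_sdiff B hA, Set.inter_comm B A] at hle
    exact (ENNReal.add_le_add_iff_left hinter).1 hle
  rw [← lintegral_inter_add_sdiff w A hB, ← lintegral_inter_add_sdiff w B hA, Set.inter_comm B A]
  refine add_le_add le_rfl ?_
  calc ∫⁻ z in A \ B, w z ∂ν ≤ ∫⁻ _ in A \ B, c ∂ν :=
        setLIntegral_mono measurable_const fun z hz => hwA z hz.1
    _ = c * ν (A \ B) := setLIntegral_const _ _
    _ ≤ c * ν (B \ A) := by gcongr
    _ = ∫⁻ _ in B \ A, c ∂ν := (setLIntegral_const _ _).symm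
    _ ≤ ∫⁻ z in B \ A, w z ∂ν := setLIntegral_mono' (hB.diff hA) fun z hz => hwB z hz.2

section Polar

variable {E : Type*} [NormedAddCommGroup E] [NormedSpace ℝ E] [NormedSpace ℂ E]
  [IsScalarTower ℝ ℂ E] [FiniteDimensional ℝ E] [MeasurableSpace E] [BorelSpace E]

theorem map_complex_smul_addHaar (μ : Measure E) [μ.IsAddHaarMeasure] {z : ℂ} (hz : z ≠ 0) :
    μ.map (z • ·) = (‖z‖ₑ ^ (2 * Module.finrank ℂ E))⁻¹ • μ := by
  have : FiniteDimensional ℂ E := FiniteDimensional.right ℝ ℂ E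
  let f : E →ₗ[ℝ] E := (z • (LinearMap.id : E →ₗ[ℂ] E)).restrictScalars ℝ
  have hdet : LinearMap.det f = ‖z‖ ^ (2 * Module.finrank ℂ E) := by
    rw [LinearMap.det_restrictScalars, LinearMap.det_smul, LinearMap.det_id, mul_one,
      Algebra.norm_complex_apply, Complex.normSq_eq_norm_sq, norm_pow, ← pow_mul, mul_comm]
  have hpos : 0 < ‖z‖ ^ (2 * Module.finrank ℂ E) := by positivity
  have hmap := Measure.map_linearMap_addHaar_eq_smul_addHaar μ (f := f)
    (by rw [hdet]; exact hpos.ne')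
  rw [hdet, abs_of_pos (inv_pos.2 hpos), ENNReal.ofReal_inv_of_pos hpos,
    ENNReal.ofReal_pow (norm_nonneg _), ofReal_norm] at hmap
  exact hmap

theorem lintegral_comp_complex_smul (μ : Measure E) [μ.IsAddHaarMeasure] {z : ℂ} (hz : z ≠ 0)
    {F : E → ℝ≥0∞} (hF : Measurable F) :
    ∫⁻ x, F (z • x) ∂μ = (‖z‖ₑ ^ (2 * Module.finrank ℂ E))⁻¹ * ∫⁻ x, F x ∂μ := by
  rw [← lintegral_map hF (measurable_const_smul z), map_complex_smul_addHaar μ hz,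
    lintegral_smul_measure, smul_eq_mul]

/-- The integral of `|z|⁻²` over an annulus, which normalizes the polar decomposition along
complex lines. -/
noncomputable def annulusMass (ν : Measure ℂ) : ℝ≥0∞ :=
  ∫⁻ z, (‖z‖ₑ ^ 2)⁻¹ * (Set.Ioo (1 / 2 : ℝ) 2).indicator 1 ‖z‖⁻¹ ∂ν

theorem annulusMass_ne_zero (ν : Measure ℂ) [ν.IsAddHaarMeasure] : annulusMass ν ≠ 0 := by
  refine ((lintegral_pos_iff_support ?_).2 ?_).ne'
  · have : Measurable ((Set.Ioo (1 / 2 : ℝ) 2).indicator (1 : ℝ → ℝ≥0∞)) :=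
      measurable_one.indicator measurableSet_Ioo
    fun_prop
  · have hopen : IsOpen {z : ℂ | 1 / 2 < ‖z‖ ∧ ‖z‖ < 2} :=
      (isOpen_lt continuous_const continuous_norm).inter
        (isOpen_lt continuous_norm continuous_const)
    refine (hopen.measure_pos ν ⟨1, by norm_num⟩).trans_le (measure_mono ?_)
    rintro z ⟨h1, h2⟩
    have hz : 0 < ‖z‖ := by linarith
    have hmem : ‖z‖⁻¹ ∈ Set.Ioo (1 / 2 : ℝ) 2 := by
      constructor
      · rw [one_div]; exact inv_strictAnti₀ hz h2
      · rw [inv_lt_comm₀ hz two_pos]; linarith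
    simp only [Function.mem_support]
    rw [Set.indicator_of_mem hmem]
    simp

theorem annulusMass_ne_top (ν : Measure ℂ) [ν.IsAddHaarMeasure] : annulusMass ν ≠ ∞ := by
  refine ne_top_of_le_ne_top (b := 4 * ν (closedBall 0 2)) 
    (ENNReal.mul_ne_top (by finiteness) measure_closedBall_lt_top.ne) ?_
  rw [← lintegral_indicator_const isClosed_closedBall.measurableSet]
  refine lintegral_mono fun z => ?_
  by_cases hmem : ‖z‖⁻¹ ∈ Set.Ioo (1 / 2 : ℝ) 2
  · have hz : 0 < ‖z‖ := inv_pos.1 (lt_trans (by norm_num) hmem.1)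
    have h1 : ‖z‖ ≤ 2 := by
      have := (lt_inv_comm₀ (by norm_num) hz).1 hmem.1
      norm_num at this; exact this.le
    have h2 : 1 / 2 ≤ ‖z‖ := by
      have := (inv_lt_comm₀ hz (by norm_num)).1 hmem.2
      rw [one_div]; exact this.le
    rw [Set.indicator_of_mem hmem, Set.indicator_of_mem (by simpa using h1), Pi.one_apply, mul_one,
      ← ofReal_norm, ← ENNReal.ofReal_pow hz.le, ← ENNReal.ofReal_inv_of_pos (by positivity)]
    rw [show (4 : ℝ≥0∞) = ENNReal.ofReal 4 by norm_num]
    refine ENNReal.ofReal_le_ofReal ?_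
    rw [inv_le_comm₀ (by positivity) (by norm_num)]
    nlinarith
  · rw [Set.indicator_of_notMem hmem]; simp

theorem lintegral_annulus_scale (ν : Measure ℂ) [ν.IsAddHaarMeasure] {r : ℝ} (hr : 0 < r) :
    ∫⁻ z, (‖z‖ₑ ^ 2)⁻¹ * (Set.Ioo (1 / 2 : ℝ) 2).indicator 1 (‖z‖⁻¹ * r) ∂ν = annulusMass ν := by
  have hk : Measurable ((Set.Ioo (1 / 2 : ℝ) 2).indicator (1 : ℝ → ℝ≥0∞)) :=
    measurable_one.indicator measurableSet_Ioo
  have hr' : (r : ℂ) ≠ 0 := by exact_mod_cast hr.ne'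
  have h0 : ‖(r : ℂ)‖ₑ ^ 2 ≠ 0 := by simp [hr.ne']
  have h1 : ‖(r : ℂ)‖ₑ ^ 2 ≠ ∞ := by finiteness
  have key := lintegral_comp_complex_smul ν hr'
    (F := fun z => (‖z‖ₑ ^ 2)⁻¹ * (Set.Ioo (1 / 2 : ℝ) 2).indicator 1 (‖z‖⁻¹ * r)) (by fun_prop)
  rw [Module.finrank_self, mul_one] at key
  have hscale : ∀ z : ℂ, (‖(r : ℂ) • z‖ₑ ^ 2)⁻¹ *
      (Set.Ioo (1 / 2 : ℝ) 2).indicator (1 : ℝ → ℝ≥0∞) (‖(r : ℂ) • z‖⁻¹ * r) =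
      (‖(r : ℂ)‖ₑ ^ 2)⁻¹ *
        ((‖z‖ₑ ^ 2)⁻¹ * (Set.Ioo (1 / 2 : ℝ) 2).indicator 1 ‖z‖⁻¹) := by
    intro z
    have : ‖(r : ℂ) • z‖⁻¹ * r = ‖z‖⁻¹ := by
      rw [norm_smul, Complex.norm_real, Real.norm_of_nonneg hr.le]
      field_simp
    rw [this, enorm_smul, mul_pow, ENNReal.mul_inv (Or.inl h0) (Or.inl h1), mul_assoc]
  simp_rw [hscale] at key
  rw [lintegral_const_mul _ (by fun_prop)] at key
  exact ((ENNReal.mul_right_inj (ENNReal.inv_ne_zero.2 h1) (ENNReal.inv_ne_top.2 h0)).1 key).symm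

/-- Integration in polar coordinates along complex lines: up to a universal factor, the measure of
`D` is an average of the integrals of `|z|^(2n-2)` over the slices `{z | z • x ∈ D}`. -/
theorem lintegral_slice_eq (μ : Measure E) [μ.IsAddHaarMeasure] (ν : Measure ℂ)
    [ν.IsAddHaarMeasure] (hn : 1 ≤ Module.finrank ℂ E) {D : Set E} (hD : MeasurableSet D) :
    ∫⁻ x, (Set.Ioo (1 / 2 : ℝ) 2).indicator 1 ‖x‖ *
      ∫⁻ z in {z : ℂ | z • x ∈ D}, ‖z‖ₑ ^ (2 * (Module.finrank ℂ E - 1)) ∂ν ∂μ =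
      annulusMass ν * μ D := by
  have : Nontrivial E := Module.nontrivial_of_finrank_pos (R := ℂ) hn
  have hk : Measurable ((Set.Ioo (1 / 2 : ℝ) 2).indicator (1 : ℝ → ℝ≥0∞)) :=
    measurable_one.indicator measurableSet_Ioo
  have hDi : Measurable (D.indicator (1 : E → ℝ≥0∞)) := measurable_one.indicator hD
  set d := Module.finrank ℂ E
  calc
    _ = ∫⁻ x, ∫⁻ z : ℂ, (Set.Ioo (1 / 2 : ℝ) 2).indicator 1 ‖x‖ *
          (D.indicator 1 (z • x) * ‖z‖ₑ ^ (2 * (d - 1))) ∂ν ∂μ := by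
      refine lintegral_congr fun x => ?_
      have hm : MeasurableSet {z : ℂ | z • x ∈ D} := (measurable_id.smul_const x) hD
      rw [lintegral_const_mul _ (by fun_prop), ← lintegral_indicator hm]
      congr 1
      refine lintegral_congr fun z => ?_
      by_cases h : z • x ∈ D
      · rw [Set.indicator_of_mem (by exact h), Set.indicator_of_mem h]; simp
      · rw [Set.indicator_of_notMem (by exact h), Set.indicator_of_notMem h]; simp
    _ = ∫⁻ z : ℂ, ∫⁻ x, (Set.Ioo (1 / 2 : ℝ) 2).indicator 1 ‖x‖ *
          (D.indicator 1 (z • x) * ‖z‖ₑ ^ (2 * (d - 1))) ∂μ ∂ν :=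
      lintegral_lintegral_swap (by fun_prop)
    _ = ∫⁻ z : ℂ, ∫⁻ x, (‖z‖ₑ ^ 2)⁻¹ * (Set.Ioo (1 / 2 : ℝ) 2).indicator 1 (‖z‖⁻¹ * ‖x‖) *
          D.indicator 1 x ∂μ ∂ν := by
      refine lintegral_congr_ae ?_
      filter_upwards [compl_mem_ae_iff.2 (measure_singleton (0 : ℂ))] with z (hz : z ≠ 0)
      have h0 : ‖z‖ₑ ≠ 0 := by simpa using hz
      have h1 : ‖z‖ₑ ≠ ∞ := by finiteness
      have key := lintegral_comp_complex_smul μ hz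
        (F := fun y => (Set.Ioo (1 / 2 : ℝ) 2).indicator 1 (‖z‖⁻¹ * ‖y‖) * D.indicator 1 y)
        (by fun_prop)
      calc
        _ = ∫⁻ x, ‖z‖ₑ ^ (2 * (d - 1)) *
              ((Set.Ioo (1 / 2 : ℝ) 2).indicator 1 (‖z‖⁻¹ * ‖z • x‖) *
                D.indicator 1 (z • x)) ∂μ := by
          refine lintegral_congr fun x => ?_
          rw [norm_smul, inv_mul_cancel_left₀ (norm_ne_zero_iff.2 hz)]
          ring
        _ = (‖z‖ₑ ^ 2)⁻¹ * ∫⁻ x, (Set.Ioo (1 / 2 : ℝ) 2).indicator 1 (‖z‖⁻¹ * ‖x‖) *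
              D.indicator 1 x ∂μ := by
          rw [lintegral_const_mul _ (by fun_prop), key, ← mul_assoc]
          congr 1
          rw [show 2 * Module.finrank ℂ E = 2 * (d - 1) + 2 by omega, pow_add,
            ENNReal.mul_inv (by simp [h0]) (by simp [h1]), ← mul_assoc,
            ENNReal.mul_inv_cancel (by simp [h0]) (by simp [h1]), one_mul]
        _ = _ := by
          rw [← lintegral_const_mul _ (by fun_prop)]
          simp_rw [mul_assoc]
    _ = ∫⁻ x, ∫⁻ z : ℂ, (‖z‖ₑ ^ 2)⁻¹ * (Set.Ioo (1 / 2 : ℝ) 2).indicator 1 (‖z‖⁻¹ * ‖x‖) *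
          D.indicator 1 x ∂ν ∂μ :=
      lintegral_lintegral_swap (by fun_prop)
    _ = ∫⁻ x, annulusMass ν * D.indicator 1 x ∂μ := by
      refine lintegral_congr_ae ?_
      filter_upwards [compl_mem_ae_iff.2 (measure_singleton (0 : E))] with x (hx : x ≠ 0)
      rw [lintegral_mul_const _ (by fun_prop), lintegral_annulus_scale ν (norm_pos_iff.2 hx)]
    _ = _ := by
      rw [lintegral_const_mul _ hDi, lintegral_indicator_one hD]

end Polar

theorem IsCircular.smul_mem_of_norm_le {n : ℕ} {D : Set (EuclideanSpace ℂ (Fin n))}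
    (hcirc : IsCircular D) (hstar : ∀ x ∈ D, ∀ t : ℝ, 0 ≤ t → t ≤ 1 → t • x ∈ D)
    {x : EuclideanSpace ℂ (Fin n)} {z w : ℂ} (hw : w • x ∈ D) (hzw : ‖z‖ ≤ ‖w‖) : z • x ∈ D := by
  rcases eq_or_ne w 0 with rfl | hw0
  · have hz : z = 0 := by simpa using hzw
    rwa [hz]
  · have hmem := hcirc _ (hstar _ hw (‖z / w‖) (norm_nonneg _)
      (by rw [norm_div]; exact div_le_one_of_le₀ hzw (norm_nonneg _))) (z / w).arg
    rw [← Complex.coe_smul, smul_smul, smul_smul, mul_comm (Complex.exp _),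
      Complex.norm_mul_exp_arg_mul_I, div_mul_cancel₀ _ hw0] at hmem
    exact hmem

theorem isometry_smul_of_norm_eq_one {n : ℕ} {ω : EuclideanSpace ℂ (Fin n)} (hω : ‖ω‖ = 1) :
    Isometry fun z : ℂ => z • ω :=
  Isometry.of_dist_eq fun z w => by
    rw [dist_eq_norm, dist_eq_norm, ← sub_smul, norm_smul, hω, mul_one]

theorem hausdorffMeasure_inter_complexLine {n : ℕ} {ω : EuclideanSpace ℂ (Fin n)} (hω : ‖ω‖ = 1)
    (D : Set (EuclideanSpace ℂ (Fin n))) :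
    μH[2] (D ∩ complexLine ω) = μH[2] {z : ℂ | z • ω ∈ D} := by
  rw [← (isometry_smul_of_norm_eq_one hω).hausdorffMeasure_image (Or.inl zero_le_two)]
  congr 1
  exact (Set.image_preimage_eq_inter_range (f := fun z : ℂ => z • ω)).symm

instance isAddHaarMeasure_hausdorffMeasure_complex :
    (μH[2] : Measure ℂ).IsAddHaarMeasure := by
  simpa using isAddHaarMeasure_hausdorffMeasure (E := ℂ)

theorem measure_slice {n : ℕ} {x : EuclideanSpace ℂ (Fin n)} (hx : x ≠ 0)
    (D : Set (EuclideanSpace ℂ (Fin n))) :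
    μH[2] {z : ℂ | z • x ∈ D} = ENNReal.ofReal |(‖x‖ ^ 2)⁻¹| *
      μH[2] {z : ℂ | z • ((‖x‖⁻¹ : ℝ) • x) ∈ D} := by
  have hx' : ‖x‖ ≠ 0 := norm_ne_zero_iff.2 hx
  rw [← Complex.finrank_real_complex, ← Measure.addHaar_preimage_smul _ hx']
  congr 1
  ext z
  simp only [Set.mem_ofPred_eq, Set.mem_preimage]
  rw [← Complex.coe_smul, ← Complex.coe_smul, smul_smul, smul_eq_mul, mul_right_comm,
    ← Complex.ofReal_mul, mul_inv_cancel₀ hx', Complex.ofReal_one, one_mul]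

/-- (Busemann–Petty type theorem for complex lines.) If `A, B` are
origin-symmetric star bodies in `ℂⁿ` (`n ≥ 1`), `A` is circular, and every complex-line
cross-section of `A` has area at most that of `B`, then `vol(A) ≤ vol(B)`. -/
theorem volume_le_volume_of_area_le_area
    (n : ℕ) (hn : 1 ≤ n) (A B : Set (EuclideanSpace ℂ (Fin n)))
    (hA : IsStarBody A) (hB : IsStarBody B)
    (hAsymm : A = -A) (hBsymm : B = -B) (hAcirc : IsCircular A)
    (harea : ∀ ω ∈ sphere (0 : EuclideanSpace ℂ (Fin n)) 1,
      μH[2] (A ∩ complexLine ω) ≤ μH[2] (B ∩ complexLine ω)) :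
    volume A ≤ volume B := by
  have hne : annulusMass μH[2] ≠ 0 := annulusMass_ne_zero _
  have htop : annulusMass μH[2] ≠ ∞ := annulusMass_ne_top _
  have hdim : 1 ≤ Module.finrank ℂ (EuclideanSpace ℂ (Fin n)) := by simpa using hn
  rw [← ENNReal.mul_le_mul_iff_right hne htop,
    ← lintegral_slice_eq volume μH[2] hdim hA.1.measurableSet,
    ← lintegral_slice_eq volume μH[2] hdim hB.1.measurableSet]
  have : Nontrivial (EuclideanSpace ℂ (Fin n)) :=
    Module.nontrivial_of_finrank_pos (R := ℂ) hdim
  refine lintegral_mono_ae ?_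
  filter_upwards [compl_mem_ae_iff.2 (measure_singleton 0)] with x (hx : x ≠ 0)
  gcongr 1
  have hω : ‖(‖x‖⁻¹ : ℝ) • x‖ = 1 := by
    rw [norm_smul, norm_inv, norm_norm, inv_mul_cancel₀ (norm_ne_zero_iff.2 hx)]
  have hmeas {D : Set (EuclideanSpace ℂ (Fin n))} (hD : IsCompact D) :
      MeasurableSet {z : ℂ | z • x ∈ D} :=
    (measurable_id.smul_const x) hD.measurableSet
  refine setLIntegral_le_setLIntegral_of_measure_le (hmeas hA.1) (hmeas hB.1) ?_ ?_
    (c := ⨆ z ∈ {z : ℂ | z • x ∈ A}, ‖z‖ₑ ^ _) (fun z hz => le_iSup₂_of_le z hz le_rfl)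
    fun z hz => iSup₂_le fun w hw => ?_
  · rw [measure_slice hx]
    exact ENNReal.mul_ne_top ENNReal.ofReal_ne_top
      ((isometry_smul_of_norm_eq_one hω).isClosedEmbedding.isCompact_preimage hA.1).measure_ne_top
  · rw [measure_slice hx, measure_slice hx, ← hausdorffMeasure_inter_complexLine hω,
      ← hausdorffMeasure_inter_complexLine hω]
    exact mul_le_mul_right (harea _ (by simpa using hω)) _
  · have hwz : ‖w‖ ≤ ‖z‖ := by
      by_contra! hlt
      exact hz (hAcirc.smul_mem_of_norm_le hA.2.2.1 hw hlt.le)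
    gcongr
    exact enorm_le_iff_norm_le.2 hwz
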